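/- Assume q mod n ∈ D₀ (so that d₀(x) and d₁(x) have coefficients in GF(q)). For i ∈ {1, 2} and j ∈ {0, 1}, the cyclic code C^{(i,j)} over GF(q) of length n with generator polynomial g^{(i,j)}(x) = (x^n−1)/((x^{n_i}−1)·d_j(x)) has dimension n_i + (n₁−1)(n₂−1)/2, and its minimum distance d^{(i,j)} satisfies (d^{(i,j)})² ≥ n_{i'}, where n_{i'} = n₂ if i = 1 and n_{i'} = n₁ if i = 2 (hence d^{(i,j)} ≥ ⌈√(n_{i'})⌉). Moreover, if −1 mod n ∈ D₁, then (d^{(i,j)})² − d^{(i,j)} + 1 ≥ n_{i'}. -/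

import Mathlib

open Polynomial

section QuadraticResidueBound

variable {ℓ : ℕ} [Fact ℓ.Prime] {K : Type*} [Field K]

/-- Fourier inversion over `ZMod ℓ` with values in an arbitrary field. -/
theorem sum_fourier_mul_char (ψ : AddChar (ZMod ℓ) K) (hψ : ψ.IsPrimitive)
    (f : ZMod ℓ → K) (s : ZMod ℓ) :
    ∑ y, (∑ t, f t * ψ (t * y)) * ψ (-(y * s)) = ℓ * f s := by
  have h : ∀ y, (∑ t, f t * ψ (t * y)) * ψ (-(y * s)) = ∑ t, f t * ψ (y * (t - s)) := by
    intro y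
    rw [Finset.sum_mul]
    refine Finset.sum_congr rfl fun t _ => ?_
    rw [mul_assoc, ← AddChar.map_add_eq_mul]
    congr 2
    ring
  simp_rw [h]
  rw [Finset.sum_comm]
  simp_rw [← Finset.mul_sum, AddChar.sum_mulShift _ hψ, sub_eq_zero]
  simp [ZMod.card, mul_comm]

/-- A twisted Kloosterman sum whose parameters have opposite quadratic characters vanishes. -/
theorem sum_quadraticChar_mul_char_eq_zero (ψ : AddChar (ZMod ℓ) K) {a y : ZMod ℓ}
    (hay : quadraticChar (ZMod ℓ) a * quadraticChar (ZMod ℓ) y = -1) :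
    ∑ s, (quadraticChar (ZMod ℓ) s : K) * ψ (a * s⁻¹ + s * y) = 0 := by
  have ha : a ≠ 0 := by rintro rfl; simp at hay
  have hy : y ≠ 0 := by rintro rfl; simp at hay
  have hχ : ∀ z : ZMod ℓ, quadraticChar (ZMod ℓ) z⁻¹ = quadraticChar (ZMod ℓ) z := by
    intro z
    by_cases hz : z = 0
    · simp [hz]
    · have h1 : quadraticChar (ZMod ℓ) z⁻¹ * quadraticChar (ZMod ℓ) z = 1 := by
        rw [← map_mul, inv_mul_cancel₀ hz, map_one]
      rcases quadraticChar_dichotomy hz with h | h <;> rw [h] at h1 ⊢ <;> linarith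
  have key : ∀ s, quadraticChar (ZMod ℓ) (a * (y * s)⁻¹) = -quadraticChar (ZMod ℓ) s := by
    intro s
    rw [map_mul, hχ, map_mul, ← mul_assoc, hay, neg_one_mul]
  refine Finset.sum_involution (fun s _ => a * (y * s)⁻¹) ?_ ?_ ?_ ?_
  · intro s _
    by_cases hs : s = 0
    · simp [hs]
    · have : a * (a * (y * s)⁻¹)⁻¹ + a * (y * s)⁻¹ * y = a * s⁻¹ + s * y := by
        field_simp
        ring
      rw [key, this]
      push_cast
      ring
  · intro s _ hs heq
    have h1 := key s
    rw [heq] at h1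
    have h0 : quadraticChar (ZMod ℓ) s = 0 := by linarith
    simp [h0] at hs
  · simp
  · intro s _
    by_cases hs : s = 0
    · simp [hs]
    · field_simp

/-- The square root bound for quadratic residue codes of prime length, over any field containing
the required roots of unity. -/
theorem le_card_support_sq (hℓ : ℓ ≠ 2) (hK : (ℓ : K) ≠ 0) (ψ : AddChar (ZMod ℓ) K)
    (hψ : ψ.IsPrimitive) {ε : ℤ} (hε : ε = 1 ∨ ε = -1) (f : ZMod ℓ → K) (hf : f ≠ 0)
    (hz : ∀ y, y ≠ 0 → quadraticChar (ZMod ℓ) y ≠ ε → ∑ t, f t * ψ (t * y) = 0) :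
    ℓ ≤ (Function.support f).ncard ^ 2 := by
  classical
  induction hw : (Function.support f).ncard using Nat.strong_induction_on generalizing f with
  | _ w ih =>
  subst hw
  by_cases h0 : ∑ t, f t = 0
  · obtain ⟨t₀, ht₀⟩ := Function.ne_iff.mp hf
    obtain ⟨t₁, ht₁, hne⟩ : ∃ t₁, f t₁ ≠ 0 ∧ t₁ ≠ t₀ := by
      by_contra! h
      rw [Finset.sum_eq_single t₀ (fun b _ hb => by_contra fun hb' => hb (h b hb'))
        (by simp)] at h0
      exact ht₀ h0
    set f' : ZMod ℓ → K := fun s => (quadraticChar (ZMod ℓ) s : K) * f (t₀ - s⁻¹) with hf'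
    have hlt : (Function.support f').ncard < (Function.support f).ncard := by
      have hinj : (Function.support f').ncard ≤ (Function.support f \ {t₀}).ncard := by
        refine Set.ncard_le_ncard_of_injOn (fun s => t₀ - s⁻¹) ?_ ?_ (Set.toFinite _)
        · intro s hs
          simp only [hf', Function.mem_support, ne_eq, mul_eq_zero, not_or] at hs
          refine ⟨hs.2, fun h => hs.1 ?_⟩
          have : s = 0 := by simpa using h
          simp [this]
        · intro s _ s' _ h
          simpa using h
      have := Set.ncard_sdiff_singleton_lt_of_mem (s := Function.support f) ht₀ (Set.toFinite _)
      omega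
    refine (ih _ hlt f' ?_ ?_ rfl).trans (Nat.pow_le_pow_left hlt.le 2)
    · refine Function.ne_iff.mpr ⟨(t₀ - t₁)⁻¹, ?_⟩
      have h1 : (t₀ - t₁)⁻¹ ≠ 0 := inv_ne_zero (sub_ne_zero.mpr hne.symm)
      simp only [hf', inv_inv, sub_sub_cancel, Pi.zero_apply]
      refine mul_ne_zero ?_ ht₁
      rcases quadraticChar_dichotomy h1 with h | h <;> simp [h]
    · intro y hy hyε
      have h2 : (ℓ : K) * ∑ s, f' s * ψ (s * y) = ∑ a, (∑ t, f t * ψ (t * a)) * ψ (-(a * t₀)) *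
          ∑ s, (quadraticChar (ZMod ℓ) s : K) * ψ (a * s⁻¹ + s * y) := by
        simp_rw [Finset.mul_sum (s := (Finset.univ : Finset (ZMod ℓ)))
          (f := fun s => (quadraticChar (ZMod ℓ) s : K) * ψ (_ * s⁻¹ + s * y))]
        rw [Finset.sum_comm, Finset.mul_sum]
        refine Finset.sum_congr rfl fun s _ => ?_
        have h3 := sum_fourier_mul_char ψ hψ f (t₀ - s⁻¹)
        calc (ℓ : K) * (f' s * ψ (s * y))
            = (quadraticChar (ZMod ℓ) s : K) * ψ (s * y) * (ℓ * f (t₀ - s⁻¹)) := by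
              simp only [hf']; ring
          _ = _ := by
              rw [← h3, Finset.mul_sum]
              refine Finset.sum_congr rfl fun a _ => ?_
              have : ψ (-(a * (t₀ - s⁻¹))) = ψ (-(a * t₀)) * ψ (a * s⁻¹) := by
                rw [← AddChar.map_add_eq_mul]; congr 1; ring
              rw [this, AddChar.map_add_eq_mul]
              ring
      have h4 : (ℓ : K) * ∑ s, f' s * ψ (s * y) = 0 := by
        rw [h2]
        refine Finset.sum_eq_zero fun a _ => ?_
        by_cases ha : a = 0
        · simp [ha, h0]
        by_cases haε : quadraticChar (ZMod ℓ) a = ε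
        · rw [sum_quadraticChar_mul_char_eq_zero, mul_zero]
          rcases quadraticChar_dichotomy hy with h | h <;> rcases hε with h' | h' <;>
            simp_all
        · rw [hz a ha haε]; simp
      exact (mul_eq_zero.mp h4).resolve_left hK
  · obtain ⟨r, hr⟩ := quadraticChar_exists_neg_one (F := ZMod ℓ) (by rwa [ZMod.ringChar_zmod_n])
    have hr0 : r ≠ 0 := by rintro rfl; simp at hr
    set h : ZMod ℓ → K := fun s => ∑ t, f t * f ((s - t) * r) with hh
    have hfour : ∀ y, ∑ s, h s * ψ (s * y) =
        (∑ t, f t * ψ (t * y)) * ∑ t, f t * ψ (t * (r⁻¹ * y)) := by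
      intro y
      simp_rw [hh, Finset.sum_mul]
      rw [Finset.sum_comm]
      refine Finset.sum_congr rfl fun t _ => ?_
      rw [Finset.mul_sum]
      refine Fintype.sum_bijective (fun s => (s - t) * r)
        ((mulRight_bijective₀ r hr0).comp (Equiv.subRight t).bijective) _ _ fun s => ?_
      have : ψ (s * y) = ψ (t * y) * ψ ((s - t) * r * (r⁻¹ * y)) := by
        rw [← AddChar.map_add_eq_mul]; congr 1; field_simp; ring
      rw [this]; ring
    have hzero : ∀ y, y ≠ 0 → ∑ s, h s * ψ (s * y) = 0 := by
      intro y hy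
      rw [hfour]
      by_cases hyε : quadraticChar (ZMod ℓ) y = ε
      · rw [hz (r⁻¹ * y) (mul_ne_zero (inv_ne_zero hr0) hy), mul_zero]
        intro hc
        have : quadraticChar (ZMod ℓ) r * quadraticChar (ZMod ℓ) (r⁻¹ * y) =
            quadraticChar (ZMod ℓ) y := by
          rw [← map_mul, mul_inv_cancel_left₀ hr0]
        rw [hr, hc, hyε] at this
        rcases hε with h' | h' <;> rw [h'] at this <;> norm_num at this
      · rw [hz y hy hyε, zero_mul]
    have hne : ∀ s, h s ≠ 0 := by
      intro s hs
      have h1 := sum_fourier_mul_char ψ hψ h s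
      rw [Finset.sum_eq_single 0 (fun y _ hy => by rw [hzero y hy, zero_mul]) (by simp),
        hfour, hs] at h1
      simp [h0] at h1
    have hsurj : (Set.univ : Set (ZMod ℓ)) ⊆ (fun x : ZMod ℓ × ZMod ℓ => x.1 + x.2 * r⁻¹) ''
        (Function.support f ×ˢ Function.support f) := by
      intro s _
      obtain ⟨t, -, ht⟩ := Finset.exists_ne_zero_of_sum_ne_zero (hne s)
      refine ⟨(t, (s - t) * r), ⟨left_ne_zero_of_mul ht, right_ne_zero_of_mul ht⟩, ?_⟩
      simp only
      field_simp
      ring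
    have h1 := (Set.ncard_le_ncard hsurj (Set.toFinite _)).trans
      (Set.ncard_image_le (Set.toFinite _))
    rwa [Set.ncard_univ, Nat.card_zmod, Set.ncard_prod, ← sq] at h1

end QuadraticResidueBound

/-- A polynomial of degree less than `ν * ℓ` vanishing at every `β ^ j` for which `ℓ ∤ j` and the
Jacobi-type symbol of `j` differs from the sign `σ` either has at least `ℓ` terms, or has more
terms than `N` for some `N` with `ℓ ≤ N ^ 2`. -/
theorem le_card_support_or_exists_sq {ν ℓ : ℕ} [Fact ν.Prime] [Fact ℓ.Prime] (hne : ν ≠ ℓ)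
    (hℓ : ℓ ≠ 2) {K : Type*} [Field K] (hK : (ℓ : K) ≠ 0) {β : K}
    (hβ : IsPrimitiveRoot β (ν * ℓ)) {P : K[X]} (hP : P ≠ 0) (hdeg : P.natDegree < ν * ℓ)
    {σ : ℤ} (hσ : σ = 1 ∨ σ = -1)
    (hz : ∀ j : ℕ, ¬ ℓ ∣ j →
      quadraticChar (ZMod ν) j * quadraticChar (ZMod ℓ) j ≠ σ → P.eval (β ^ j) = 0) :
    ℓ ≤ P.support.card ∨ ∃ N < P.support.card, ℓ ≤ N ^ 2 := by
  classical
  have hνp : ν.Prime := Fact.out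
  have hℓp : ℓ.Prime := Fact.out
  have hcop : ν.Coprime ℓ := (Nat.coprime_primes hνp hℓp).mpr hne
  have hpos : 0 < ν * ℓ := Nat.mul_pos hνp.pos hℓp.pos
  have hω : IsPrimitiveRoot (β ^ ν) ℓ := hβ.pow hpos rfl
  set ψ : AddChar (ZMod ℓ) K := AddChar.zmodChar ℓ hω.pow_eq_one
  have hψ : ψ.IsPrimitive := AddChar.zmodChar_primitive_of_primitive_root ℓ hω
  have hψnat : ∀ a : ℕ, ψ a = (β ^ ν) ^ a := AddChar.zmodChar_apply' hω.pow_eq_one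
  have hνℓ : (ν : ZMod ℓ) ≠ 0 := by
    rw [Ne, ZMod.natCast_eq_zero_iff, Nat.prime_dvd_prime_iff_eq hℓp hνp]
    exact hne.symm
  have hℓν : (ℓ : ZMod ν) ≠ 0 := by
    rwa [Ne, ZMod.natCast_eq_zero_iff, Nat.prime_dvd_prime_iff_eq hνp hℓp]
  let f : ℕ → ZMod ℓ → K := fun x t =>
    ∑ k ∈ P.support.filter fun k : ℕ => (k : ZMod ℓ) = t, P.coeff k * β ^ (ℓ * x * k)
  have hfour : ∀ x y : ℕ, ∑ t, f x t * ψ (t * (y : ZMod ℓ)) = P.eval (β ^ (ℓ * x + ν * y)) := by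
    intro x y
    rw [eval_eq_sum, Polynomial.sum, ← Finset.sum_fiberwise P.support (fun k : ℕ => (k : ZMod ℓ))]
    refine Finset.sum_congr rfl fun t _ => ?_
    rw [Finset.sum_mul]
    refine Finset.sum_congr rfl fun k hk => ?_
    rw [← (Finset.mem_filter.mp hk).2, ← Nat.cast_mul, hψnat]
    ring
  have hvanish : ∀ (x : ℕ) (y : ZMod ℓ), y ≠ 0 →
      quadraticChar (ZMod ν) (ℓ * x) * quadraticChar (ZMod ℓ) (ν * y) ≠ σ →
      ∑ t, f x t * ψ (t * y) = 0 := by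
    intro x y hy hχ
    obtain ⟨y, rfl⟩ := ZMod.natCast_zmod_surjective y
    rw [hfour]
    refine hz _ ?_ ?_
    · rw [← ZMod.natCast_eq_zero_iff]
      push_cast
      simpa using ⟨hνℓ, hy⟩
    · simpa using hχ
  obtain ⟨x, hx⟩ : ∃ x, f x ≠ 0 := by
    by_contra! h
    refine hP (P.eq_zero_of_natDegree_lt_card_of_eval_eq_zero (f := fun j : Fin (ν * ℓ) => β ^ j.1)
      (fun i j hij => Fin.ext (hβ.pow_inj i.2 j.2 hij)) (fun j => ?_) (by simpa using hdeg))
    obtain ⟨x, hx⟩ := ZMod.natCast_zmod_surjective ((ℓ : ZMod ν)⁻¹ * ((j.1 : ℕ) : ZMod ν))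
    obtain ⟨y, hy⟩ := ZMod.natCast_zmod_surjective ((ν : ZMod ℓ)⁻¹ * ((j.1 : ℕ) : ZMod ℓ))
    have hj : ℓ * x + ν * y ≡ j.1 [MOD ν * ℓ] := by
      rw [← Nat.modEq_and_modEq_iff_modEq_mul hcop, ← ZMod.natCast_eq_natCast_iff,
        ← ZMod.natCast_eq_natCast_iff]
      push_cast
      rw [hx, hy]
      simp [mul_inv_cancel_left₀ hℓν, mul_inv_cancel_left₀ hνℓ]
    have : β ^ j.1 = β ^ (ℓ * x + ν * y) := by
      rw [(orderOf_pos_iff.mp (hβ.eq_orderOf ▸ hpos)).pow_eq_pow_iff_modEq, ← hβ.eq_orderOf]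
      exact hj.symm
    rw [this, ← hfour, h x]
    simp
  have hsub : ∀ x, Function.support (f x) ⊆ (P.support.image (fun k : ℕ => (k : ZMod ℓ)) : Set _) := by
    intro x t ht
    obtain ⟨k, hk, -⟩ := Finset.exists_ne_zero_of_sum_ne_zero ht
    rw [Finset.mem_filter] at hk
    exact Finset.mem_coe.mpr (Finset.mem_image.mpr ⟨k, hk.1, hk.2⟩)
  have hle : (P.support.image (fun k : ℕ => (k : ZMod ℓ))).card ≤ P.support.card :=
    Finset.card_image_le
  by_cases hf0 : f 0 = 0
  · right
    refine ⟨(P.support.image (fun k : ℕ => (k : ZMod ℓ))).card, lt_of_le_of_ne hle fun heq => ?_, ?_⟩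
    · have hinj := Finset.card_image_iff.mp heq
      obtain ⟨k, hk⟩ : P.support.Nonempty := by simpa using hP
      have h1 := congrFun hf0 (k : ZMod ℓ)
      have h2 : (P.support.filter fun i : ℕ => (i : ZMod ℓ) = k) = {k} := by
        ext i
        simp only [Finset.mem_filter, Finset.mem_singleton]
        exact ⟨fun hi => hinj hi.1 hk hi.2, by rintro rfl; exact ⟨hk, rfl⟩⟩
      simp only [f, h2, Finset.sum_singleton, mul_zero, zero_mul, pow_zero, mul_one,
        Pi.zero_apply] at h1
      exact (mem_support_iff.mp hk) h1
    · have hx0 : ((ℓ : ZMod ν) * x) ≠ 0 := by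
        refine mul_ne_zero hℓν fun h0 => hx ?_
        rw [ZMod.natCast_eq_zero_iff] at h0
        obtain ⟨z, rfl⟩ := h0
        rw [← hf0]
        funext t
        refine Finset.sum_congr rfl fun k _ => ?_
        have : ℓ * (ν * z) * k = ν * ℓ * (z * k) := by ring
        rw [this, pow_mul, hβ.pow_eq_one]
        simp
      have h1 := quadraticChar_dichotomy hx0
      have h2 := quadraticChar_dichotomy hνℓ
      refine (le_card_support_sq hℓ hK ψ hψ (f := f x) (ε := σ *
        quadraticChar (ZMod ν) (ℓ * x) * quadraticChar (ZMod ℓ) ν) ?_ hx ?_).trans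
        (Nat.pow_le_pow_left ?_ 2)
      · rcases hσ with h | h <;> rcases h1 with h1 | h1 <;> rcases h2 with h2 | h2 <;>
          simp [h, h1, h2]
      · intro y hy hyε
        refine hvanish x y hy fun hc => hyε ?_
        rw [← hc, map_mul (quadraticChar (ZMod ℓ))]
        rcases h1 with h1 | h1 <;> rcases h2 with h2 | h2 <;> simp [h1, h2]
      · rw [← Set.ncard_coe_finset]
        exact Set.ncard_le_ncard (by simpa using hsub x) (Set.toFinite _)
  · left
    have hzero : ∀ y : ZMod ℓ, y ≠ 0 → ∑ t, f 0 t * ψ (t * y) = 0 := by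
      intro y hy
      refine hvanish 0 y hy ?_
      rcases hσ with h | h <;> simp [h]
    have hconst : ∀ s, (ℓ : K) * f 0 s = ∑ t, f 0 t := by
      intro s
      rw [← sum_fourier_mul_char ψ hψ, Finset.sum_eq_single 0
        (fun y _ hy => by rw [hzero y hy, zero_mul]) (by simp)]
      simp
    obtain ⟨s₀, hs₀⟩ := Function.ne_iff.mp hf0
    have hall : ∀ s, s ∈ Function.support (f 0) := by
      intro s hs
      have h1 := (hconst s₀).trans (hconst s).symm
      rw [hs, mul_zero] at h1
      exact hs₀ ((mul_eq_zero.mp h1).resolve_left hK)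
    refine le_trans (le_of_eq ?_) hle
    have huniv : P.support.image (fun k : ℕ => (k : ZMod ℓ)) = Finset.univ :=
      Finset.eq_univ_iff_forall.mpr fun s => Finset.mem_coe.mp (hsub 0 (hall s))
    rw [huniv, Finset.card_univ, ZMod.card]

/-- A primitive root modulo an odd prime is a quadratic non-residue. -/
theorem quadraticChar_eq_neg_one_of_orderOf {p : ℕ} [Fact p.Prime] (hp : p ≠ 2) {g : ZMod p}
    (hg : orderOf g = p - 1) : quadraticChar (ZMod p) g = -1 := by
  have hp2 : 2 < p := lt_of_le_of_ne (Fact.out : p.Prime).two_le hp.symm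
  rw [quadraticChar_neg_one_iff_not_isSquare]
  intro hsq
  have hg0 : g ≠ 0 := by
    rintro rfl
    rw [orderOf_zero] at hg
    omega
  have h1 := (ZMod.euler_criterion p hg0).mp hsq
  have h2 := Nat.le_of_dvd (by omega) (orderOf_dvd_of_pow_eq_one h1)
  omega

section WhitemanClasses

variable {n₁ n₂ g u : ℕ} [Fact n₁.Prime] [Fact n₂.Prime]

/-- The product of the two quadratic characters on the Whiteman class of index `i`. -/
theorem quadraticChar_mul_quadraticChar_whiteman (h₁ : n₁ ≠ 2) (h₂ : n₂ ≠ 2)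
    (hg₁ : orderOf (g : ZMod n₁) = n₁ - 1) (hg₂ : orderOf (g : ZMod n₂) = n₂ - 1)
    (hu₁ : (u : ZMod n₁) = (g : ZMod n₁)) (hu₂ : (u : ZMod n₂) = 1) (s i j : ℕ)
    (hj : (j : ZMod (n₁ * n₂)) = (g : ZMod (n₁ * n₂)) ^ s * (u : ZMod (n₁ * n₂)) ^ i) :
    quadraticChar (ZMod n₁) j * quadraticChar (ZMod n₂) j = (-1) ^ i := by
  have hmod : j ≡ g ^ s * u ^ i [MOD n₁ * n₂] := by
    rw [← ZMod.natCast_eq_natCast_iff, hj]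
    push_cast
    rfl
  have e₁ := (ZMod.natCast_eq_natCast_iff _ _ _).mpr (hmod.of_mul_right n₂)
  have e₂ := (ZMod.natCast_eq_natCast_iff _ _ _).mpr (hmod.of_mul_left n₁)
  rw [e₁, e₂]
  push_cast
  rw [hu₁, hu₂]
  simp only [map_mul, map_pow, quadraticChar_eq_neg_one_of_orderOf h₁ hg₁,
    quadraticChar_eq_neg_one_of_orderOf h₂ hg₂, one_pow, mul_one]
  have : ((-1 : ℤ) ^ s) * (-1) ^ s = 1 := by rw [← mul_pow]; simp
  linear_combination (-1) ^ i * this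

/-- A union of three Whiteman classes with distinct indices below six has half of the units. -/
theorem card_union_whiteman {e : ℕ}
    (h6 : Nat.gcd (n₁ - 1) (n₂ - 1) = 6) (he : e = (n₁ - 1) * (n₂ - 1) / 6)
    (hg₁ : orderOf (g : ZMod n₁) = n₁ - 1) (hg₂ : orderOf (g : ZMod n₂) = n₂ - 1)
    (hu₁ : (u : ZMod n₁) = (g : ZMod n₁)) (hu₂ : (u : ZMod n₂) = 1)
    (W : ℕ → Finset (ZMod (n₁ * n₂)))
    (hW : ∀ i, (W i : Set (ZMod (n₁ * n₂))) =
      {x | ∃ s < e, x = (g : ZMod (n₁ * n₂)) ^ s * (u : ZMod (n₁ * n₂)) ^ i})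
    (I : Finset ℕ) (hI : ∀ i ∈ I, i < 6) (hcard : I.card = 3) :
    (I.biUnion W).card = (n₁ - 1) * (n₂ - 1) / 2 := by
  classical
  have hp₁ : n₁.Prime := Fact.out
  have hp₂ : n₂.Prime := Fact.out
  have hlcm : e = Nat.lcm (n₁ - 1) (n₂ - 1) := by rw [he, Nat.lcm, h6]
  have hd₁ : 6 ∣ n₁ - 1 := h6 ▸ Nat.gcd_dvd_left _ _
  have hd₂ : 6 ∣ n₂ - 1 := h6 ▸ Nat.gcd_dvd_right _ _
  have himage : I.biUnion W = (I ×ˢ Finset.range e).image (fun x : ℕ × ℕ =>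
      (g : ZMod (n₁ * n₂)) ^ x.2 * (u : ZMod (n₁ * n₂)) ^ x.1) := by
    ext x
    simp only [Finset.mem_biUnion, Finset.mem_image, Finset.mem_product, Finset.mem_range,
      Prod.exists]
    have hmem : ∀ i, x ∈ W i ↔
        ∃ s < e, x = (g : ZMod (n₁ * n₂)) ^ s * (u : ZMod (n₁ * n₂)) ^ i := by
      intro i
      rw [← Finset.mem_coe, hW]
      rfl
    constructor
    · rintro ⟨i, hi, hx⟩
      obtain ⟨s, hs, rfl⟩ := (hmem i).mp hx
      exact ⟨i, s, ⟨hi, hs⟩, rfl⟩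
    · rintro ⟨i, s, ⟨hi, hs⟩, rfl⟩
      exact ⟨i, hi, (hmem i).mpr ⟨s, hs, rfl⟩⟩
  have hfin₁ : IsOfFinOrder (g : ZMod n₁) :=
    orderOf_pos_iff.mp (hg₁ ▸ Nat.sub_pos_of_lt hp₁.one_lt)
  have hfin₂ : IsOfFinOrder (g : ZMod n₂) :=
    orderOf_pos_iff.mp (hg₂ ▸ Nat.sub_pos_of_lt hp₂.one_lt)
  rw [himage, Finset.card_image_of_injOn, Finset.card_product, hcard, Finset.card_range, he]
  · obtain ⟨a, ha⟩ := hd₁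
    rw [ha, mul_assoc, Nat.mul_div_cancel_left _ (by norm_num)]
    generalize a * (n₂ - 1) = b
    omega
  · rintro ⟨i, s⟩ hx ⟨j, t⟩ hy hxy
    simp only [Finset.coe_product, Set.mem_prod, Finset.mem_coe, Finset.mem_range] at hx hy hxy
    have hmod : g ^ s * u ^ i ≡ g ^ t * u ^ j [MOD n₁ * n₂] := by
      rw [← ZMod.natCast_eq_natCast_iff]
      exact_mod_cast hxy
    have e₁ := (ZMod.natCast_eq_natCast_iff _ _ _).mpr (hmod.of_mul_right n₂)
    have e₂ := (ZMod.natCast_eq_natCast_iff _ _ _).mpr (hmod.of_mul_left n₁)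
    push_cast at e₁ e₂
    rw [hu₁, ← pow_add, ← pow_add, hfin₁.pow_eq_pow_iff_modEq, hg₁] at e₁
    rw [hu₂, one_pow, one_pow, mul_one, mul_one, hfin₂.pow_eq_pow_iff_modEq, hg₂] at e₂
    have e₃ : s + i ≡ s + j [MOD 6] :=
      (e₁.of_dvd hd₁).trans ((e₂.of_dvd hd₂).symm.add_right j)
    have hij : i = j :=
      (Nat.ModEq.add_left_cancel' s e₃).eq_of_lt_of_lt (hI i hx.1) (hI j hy.1)
    subst hij
    have e₄ := Nat.ModEq.add_right_cancel' i e₁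
    have e₅ : s ≡ t [MOD e] := hlcm ▸ Nat.mod_lcm e₄ e₂
    rw [e₅.eq_of_lt_of_lt hx.2 hy.2]

end WhitemanClasses

theorem stmt_18
    (n₁ n₂ n e g u : ℕ)
    (hp₁ : n₁.Prime) (hp₂ : n₂.Prime)
    (hodd₁ : Odd n₁) (hodd₂ : Odd n₂) (hne : n₁ ≠ n₂)
    (h6 : Nat.gcd (n₁ - 1) (n₂ - 1) = 6)
    (hn : n = n₁ * n₂)
    (he : e = (n₁ - 1) * (n₂ - 1) / 6)
    (hg₁ : orderOf (g : ZMod n₁) = n₁ - 1)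
    (hg₂ : orderOf (g : ZMod n₂) = n₂ - 1)
    (hu₁ : (u : ZMod n₁) = (g : ZMod n₁))
    (hu₂ : (u : ZMod n₂) = 1)
    (W : ℕ → Finset (ZMod n))
    (hW : ∀ i, (W i : Set (ZMod n)) =
      {x | ∃ s < e, x = (g : ZMod n) ^ s * (u : ZMod n) ^ i})
    (D₀ D₁ : Finset (ZMod n))
    (hD₀ : D₀ = W 0 ∪ W 2 ∪ W 4) (hD₁ : D₁ = W 1 ∪ W 3 ∪ W 5)
    (p a q m : ℕ) (hp : p.Prime) (ha : 0 < a) (hq : q = p ^ a)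
    (hco : Nat.Coprime n q) (hm : m = orderOf (q : ZMod n))
    (F E : Type) [Field F] [Fintype F] [CharP F p]
    [Field E] [Fintype E] [CharP E p]
    (hF : Fintype.card F = q) (hE : Fintype.card E = q ^ m)
    (φ : F →+* E)
    (β : E) (hβ : IsPrimitiveRoot β n)
    (hqD₀ : ((q : ℕ) : ZMod n) ∈ D₀)
    (nᵢ nᵢ' : ℕ)
    (hi : (nᵢ = n₁ ∧ nᵢ' = n₂) ∨ (nᵢ = n₂ ∧ nᵢ' = n₁))
    (dj : Polynomial E)
    (hdj : dj = ∏ i ∈ D₀, (X - C (β ^ i.val)) ∨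
           dj = ∏ i ∈ D₁, (X - C (β ^ i.val)))
    (G : Polynomial F)
    (hG : G.map φ * ((X ^ nᵢ - 1) * dj) = X ^ n - 1) :
    n - G.natDegree = nᵢ + (n₁ - 1) * (n₂ - 1) / 2 ∧
    ∀ dmin : ℕ,
      IsLeast {w : ℕ | ∃ c : Polynomial F,
        c ≠ 0 ∧ c.natDegree < n ∧ G ∣ c ∧ w = c.support.card} dmin →
      nᵢ' ≤ dmin ^ 2 ∧
      ((-1 : ZMod n) ∈ D₁ → nᵢ' ≤ dmin ^ 2 - dmin + 1) := by
  subst hn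
  have : Fact n₁.Prime := ⟨hp₁⟩
  have : Fact n₂.Prime := ⟨hp₂⟩
  have h₁ : n₁ ≠ 2 := by rintro rfl; exact absurd hodd₁ (by decide)
  have h₂ : n₂ ≠ 2 := by rintro rfl; exact absurd hodd₂ (by decide)
  have hmem : ∀ i x, x ∈ W i ↔
      ∃ s < e, x = (g : ZMod (n₁ * n₂)) ^ s * (u : ZMod (n₁ * n₂)) ^ i := by
    intro i x
    rw [← Finset.mem_coe, hW]
    rfl
  have hU₀ : D₀ = ({0, 2, 4} : Finset ℕ).biUnion W := by
    rw [hD₀]; ext; simp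
  have hU₁ : D₁ = ({1, 3, 5} : Finset ℕ).biUnion W := by
    rw [hD₁]; ext; simp
  have hpos : 0 < n₁ * n₂ := Nat.mul_pos hp₁.pos hp₂.pos
  obtain ⟨D, I, σ, hσ, hD, hI6, hIcard, hIσ, rfl⟩ : ∃ (D : Finset (ZMod (n₁ * n₂)))
      (I : Finset ℕ) (σ : ℤ), (σ = 1 ∨ σ = -1) ∧ D = I.biUnion W ∧ (∀ i ∈ I, i < 6) ∧
      I.card = 3 ∧ (∀ i ∈ I, (-1) ^ i = σ) ∧ dj = ∏ i ∈ D, (X - C (β ^ i.val)) := by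
    rcases hdj with h | h
    · exact ⟨D₀, {0, 2, 4}, 1, .inl rfl, hU₀, by decide, rfl, by decide, h⟩
    · exact ⟨D₁, {1, 3, 5}, -1, .inr rfl, hU₁, by decide, rfl, by decide, h⟩
  have hDcard : D.card = (n₁ - 1) * (n₂ - 1) / 2 := by
    rw [hD]
    exact card_union_whiteman h6 he hg₁ hg₂ hu₁ hu₂ W hW I hI6 hIcard
  have hνℓ : nᵢ * nᵢ' = n₁ * n₂ := by
    rcases hi with ⟨rfl, rfl⟩ | ⟨rfl, rfl⟩
    · rfl
    · exact mul_comm _ _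
  have hν0 : 0 < nᵢ := Nat.pos_of_mul_pos_right (hνℓ ▸ hpos)
  have hXn : (X ^ (n₁ * n₂) - 1 : E[X]) ≠ 0 := by
    rw [← C_1]; exact X_pow_sub_C_ne_zero hpos 1
  have hXν : (X ^ nᵢ - 1 : E[X]) ≠ 0 := by
    rw [← C_1]; exact X_pow_sub_C_ne_zero hν0 1
  have hG0 : G.map φ ≠ 0 := fun h => hXn (by rw [← hG, h, zero_mul])
  have hd0 : ∏ i ∈ D, (X - C (β ^ i.val)) ≠ 0 :=
    Finset.prod_ne_zero_iff.mpr fun i _ => X_sub_C_ne_zero _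
  constructor
  · have h := congrArg natDegree hG
    rw [natDegree_mul hG0 (mul_ne_zero hXν hd0), natDegree_mul hXν hd0, natDegree_map,
      natDegree_finsetProd_X_sub_C_eq_card, hDcard, ← C_1, natDegree_X_pow_sub_C,
      natDegree_X_pow_sub_C] at h
    omega
  · rintro dmin ⟨⟨c, hc0, hcdeg, hGc, rfl⟩, -⟩
    have hc : c.support.card = (c.map φ).support.card := by
      rw [support_map_of_injective _ φ.injective]
    have hz : ∀ j : ℕ, ¬ nᵢ' ∣ j →
        quadraticChar (ZMod n₁) j * quadraticChar (ZMod n₂) j ≠ σ →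
        (c.map φ).eval (β ^ j) = 0 := by
      intro j hj hjσ
      have h := congrArg (eval (β ^ j)) hG
      have hroot : (X ^ (n₁ * n₂) - 1 : E[X]).eval (β ^ j) = 0 := by
        rw [eval_sub, eval_pow, eval_X, eval_one, ← pow_mul, mul_comm, pow_mul, hβ.pow_eq_one,
          one_pow, sub_self]
      rw [hroot, eval_mul, eval_mul] at h
      refine eval_eq_zero_of_dvd_of_eval_eq_zero (Polynomial.map_dvd φ hGc)
        ((mul_eq_zero.mp h).resolve_right (mul_ne_zero ?_ ?_))
      · simp only [eval_sub, eval_pow, eval_X, eval_one, ← pow_mul]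
        rw [sub_ne_zero, Ne, hβ.pow_eq_one_iff_dvd, ← hνℓ, mul_comm nᵢ]
        exact fun hd => hj (Nat.dvd_of_mul_dvd_mul_right hν0 hd)
      · rw [eval_prod, Finset.prod_ne_zero_iff]
        intro i hiD hi0
        have : NeZero (n₁ * n₂) := ⟨hpos.ne'⟩
        rw [eval_sub, eval_X, eval_C, sub_eq_zero,
          (orderOf_pos_iff.mp (hβ.eq_orderOf ▸ hpos)).pow_eq_pow_iff_modEq, ← hβ.eq_orderOf,
          ← ZMod.natCast_eq_natCast_iff, ZMod.natCast_zmod_val] at hi0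
        rw [hD, Finset.mem_biUnion] at hiD
        obtain ⟨k, hk, hik⟩ := hiD
        obtain ⟨s, -, hs⟩ := (hmem k i).mp hik
        exact hjσ ((quadraticChar_mul_quadraticChar_whiteman h₁ h₂ hg₁ hg₂ hu₁ hu₂ s k j
          (hi0.trans hs)).trans (hIσ k hk))
    have hcast : ∀ r : ℕ, r.Prime → r ∣ n₁ * n₂ → (r : E) ≠ 0 := by
      intro r hr hrn h0
      rw [CharP.cast_eq_zero_iff E p, Nat.prime_dvd_prime_iff_eq hp hr] at h0
      subst h0
      exact Nat.not_coprime_of_dvd_of_dvd hp.one_lt hrn (hq ▸ dvd_pow_self p ha.ne') hco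
    have hcφ : c.map φ ≠ 0 := (Polynomial.map_ne_zero_iff φ.injective).mpr hc0
    have key : nᵢ' ≤ c.support.card ∨ ∃ N < c.support.card, nᵢ' ≤ N ^ 2 := by
      rw [hc]
      rcases hi with ⟨rfl, rfl⟩ | ⟨rfl, rfl⟩
      · exact le_card_support_or_exists_sq hne h₂ (hcast _ hp₂ (dvd_mul_left _ _)) hβ hcφ
          (by rwa [natDegree_map]) hσ hz
      · exact le_card_support_or_exists_sq hne.symm h₁ (hcast _ hp₁ (dvd_mul_right _ _))
          (by rwa [mul_comm]) hcφ (by rwa [natDegree_map, mul_comm]) hσ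
          fun j hj hjσ => hz j hj (by rwa [mul_comm])
    have hbound : nᵢ' ≤ c.support.card ^ 2 - c.support.card + 1 := by
      generalize c.support.card = d at key
      rcases key with h | ⟨N, hN, h⟩
      · rcases d with _ | d
        · omega
        · have : (d + 1) ^ 2 - (d + 1) = d * (d + 1) := by
            rw [Nat.sub_eq_iff_eq_add (Nat.le_self_pow two_ne_zero _)]; ring
          rw [this]
          nlinarith
      · obtain ⟨k, rfl⟩ := Nat.exists_eq_add_of_lt hN
        have : (N + k + 1) ^ 2 - (N + k + 1) = (N + k) * (N + k + 1) := by
          rw [Nat.sub_eq_iff_eq_add (Nat.le_self_pow two_ne_zero _)]; ring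
        rw [this]
        nlinarith
    refine ⟨?_, fun _ => hbound⟩
    rcases key with h | ⟨N, hN, h⟩
    · exact h.trans (Nat.le_self_pow two_ne_zero _)
    · exact h.trans (Nat.pow_le_pow_left hN.le 2)
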